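/- For γ > 0 let f_γ(x) = (c_α/γ) exp(-(|x|/γ)^α) be a probability density on ℝ (α ≥ 2 fixed, c_α the normalizing constant). Let γ = (γ_j)_{j≥0} and β = (β_j)_{j≥0} be sequences of positive reals, and consider the product measures μ_γ = ⊗_j f_{γ_j}dx and μ_β = ⊗_j f_{β_j}dx on ℝ^ℕ. If Σ_{j≥0} ((γ_j/β_j)^{α/2} - 1)² = +∞, then μ_γ and μ_β are mutually singular. -/

import Mathlib

open MeasureTheory Real

open scoped ENNReal

lemma aux_chernoff (μ : Measure (ℕ → ℝ)) (n : ℕ) (ν : Fin n → Measure ℝ)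
    [∀ i, IsProbabilityMeasure (ν i)]
    (hμ : μ.map (fun x (i : Fin n) => x i) = Measure.pi ν)
    (r : Fin n → ℝ → ℝ≥0∞) (hr : ∀ i, Measurable (r i)) :
    μ {x | 1 ≤ ∏ i, r i (x i)} ≤ ∏ i, ∫⁻ y, r i y ∂(ν i) := by
  have hm : Measurable (fun x : ℕ → ℝ => fun (i : Fin n) => x i) := by fun_prop
  have hind : ProbabilityTheory.iIndepFun (fun (i : Fin n) (x : Fin n → ℝ) => r i (x i))
      (Measure.pi ν) :=
    ProbabilityTheory.iIndepFun_pi (fun i => (hr i).aemeasurable)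
  have hP : Measurable (fun x : Fin n → ℝ => ∏ i, r i (x i)) :=
    Finset.measurable_prod _ (fun i _ => (hr i).comp (measurable_pi_apply i))
  have h1 : μ {x | 1 ≤ ∏ i, r i (x i)} = Measure.pi ν {x | 1 ≤ ∏ i, r i (x i)} := by
    rw [← hμ, Measure.map_apply hm (measurableSet_le measurable_const hP)]
    rfl
  have h2 := mul_meas_ge_le_lintegral (μ := Measure.pi ν) hP 1
  rw [one_mul] at h2
  rw [h1]
  refine h2.trans (le_of_eq ?_)
  rw [ProbabilityTheory.lintegral_prod_eq_prod_lintegral_of_indepFun Finset.univ _ hind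
    (fun i => (hr i).comp (measurable_pi_apply i))]
  refine Finset.prod_congr rfl fun i _ => ?_
  exact (measurePreserving_eval ν i).lintegral_comp (hr i)

lemma aux_singular {Ω : Type*} [MeasurableSpace Ω] (μ ν : Measure Ω)
    [IsFiniteMeasure μ] [IsFiniteMeasure ν]
    (A : ℕ → Set Ω) (P : ℕ → ℝ≥0∞) (hA : ∀ n, μ (A n) ≤ P n) (hA' : ∀ n, ν (A n)ᶜ ≤ P n)
    (hP : Filter.Tendsto P Filter.atTop (nhds 0)) : μ ⟂ₘ ν := by
  apply Measure.mutuallySingular_of_disjoint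
  intro ρ h1 h2
  have key : ∀ n, ρ Set.univ ≤ P n + P n := fun n => by
    calc ρ Set.univ = ρ (A n ∪ (A n)ᶜ) := by rw [Set.union_compl_self]
      _ ≤ ρ (A n) + ρ (A n)ᶜ := measure_union_le _ _
      _ ≤ P n + P n := add_le_add ((h1 _).trans (hA n)) ((h2 _).trans (hA' n))
  have h0 : ρ Set.univ ≤ 0 + 0 := ge_of_tendsto' (hP.add hP) key
  have : ρ = 0 := Measure.measure_univ_eq_zero.mp (by simpa using h0)
  rw [this]
  exact Measure.zero_le _

lemma aux_one_dim (α cα : ℝ) (hα : 2 ≤ α) (hcα : 0 < cα)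
    (f : ℝ → ℝ → ℝ) (hf : ∀ g x, f g x = cα / g * Real.exp (-(|x| / g) ^ α))
    (hprob : ∀ g : ℝ, 0 < g → IsProbabilityMeasure
      ((volume : Measure ℝ).withDensity (fun x => ENNReal.ofReal (f g x))))
    (g b : ℝ) (hg : 0 < g) (hb : 0 < b) :
    ∫⁻ x, ENNReal.ofReal (√(f g x / f b x))
      ∂((volume : Measure ℝ).withDensity (fun x => ENNReal.ofReal (f b x))) =
      ENNReal.ofReal ((((g / b) ^ (α/2) + ((g / b) ^ (α/2))⁻¹) / 2) ^ (-(1/α))) := by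
  have hα0 : 0 < α := by linarith
  have hfm : ∀ g, Measurable (f g) := fun g => by
    have : f g = fun x => cα / g * Real.exp (-(|x| / g) ^ α) := funext (hf g)
    rw [this]
    fun_prop
  have hfpos : ∀ g, 0 < g → ∀ x, 0 < f g x := fun g hg x => by rw [hf]; positivity
  set s : ℝ := (g ^ (-α) + b ^ (-α)) / 2 with hs
  have hs0 : 0 < s := by positivity
  set d : ℝ := s ^ (-(1/α)) with hd
  have hd0 : 0 < d := by positivity
  have hdα : d ^ (-α) = s := by
    rw [hd, ← Real.rpow_mul hs0.le]
    have : -(1/α) * -α = 1 := by field_simp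
    rw [this, Real.rpow_one]
  have hdiv : ∀ c, 0 < c → ∀ x : ℝ, (|x| / c) ^ α = |x| ^ α * c ^ (-α) := fun c hc x => by
    rw [Real.div_rpow (abs_nonneg x) hc.le, Real.rpow_neg hc.le, div_eq_mul_inv]
  have hpt : ∀ x, √(f g x / f b x) * f b x = d / √(g * b) * f d x := by
    intro x
    have e1 : √(f g x / f b x) * f b x = √(f g x * f b x) := by
      have := hfpos b hb x
      have h2 := hfpos g hg x
      rw [eq_comm, Real.sqrt_eq_iff_mul_self_eq (by positivity) (by positivity)]
      rw [mul_mul_mul_comm, Real.mul_self_sqrt (by positivity)]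
      field_simp
    rw [e1, Real.sqrt_eq_iff_mul_self_eq (by have := hfpos b hb x; have := hfpos g hg x; positivity)
      (by have := hfpos d hd0 x; positivity), hf, hf, hf, hdiv g hg, hdiv b hb, hdiv d hd0, hdα]
    have e2 : √(g * b) * √(g * b) = g * b := Real.mul_self_sqrt (by positivity)
    have e3 : rexp (-(|x| ^ α * s)) * rexp (-(|x| ^ α * s))
        = rexp (-(|x| ^ α * g ^ (-α))) * rexp (-(|x| ^ α * b ^ (-α))) := by
      rw [← Real.exp_add, ← Real.exp_add, hs]; ring_nf
    field_simp
    rw [pow_two, pow_two, e2, e3]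
    ring
  rw [lintegral_withDensity_eq_lintegral_mul _ (by have := hfm b; fun_prop)
    (by have := hfm b; have := hfm g; fun_prop)]
  have e4 : ∀ x, ((fun x => ENNReal.ofReal (f b x)) * fun x => ENNReal.ofReal (√(f g x / f b x))) x
      = ENNReal.ofReal (d / √(g * b)) * ENNReal.ofReal (f d x) := fun x => by
    simp only [Pi.mul_apply]
    rw [← ENNReal.ofReal_mul (hfpos b hb x).le, ← ENNReal.ofReal_mul (by positivity), mul_comm, hpt]
  rw [lintegral_congr e4, lintegral_const_mul _ (by have := hfm d; fun_prop)]
  have e5 : ∫⁻ x, ENNReal.ofReal (f d x) = 1 := by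
    have := (hprob d hd0).measure_univ
    rwa [withDensity_apply _ MeasurableSet.univ, Measure.restrict_univ] at this
  rw [e5, mul_one]
  congr 1
  have e6 : ((g / b) ^ (α/2) + ((g / b) ^ (α/2))⁻¹) / 2 = s * (g * b) ^ (α / 2) := by
    have eg : g ^ (-α) = (g ^ (α/2))⁻¹ * (g ^ (α/2))⁻¹ := by
      rw [← Real.rpow_neg hg.le, ← Real.rpow_add hg]; ring_nf
    have eb : b ^ (-α) = (b ^ (α/2))⁻¹ * (b ^ (α/2))⁻¹ := by
      rw [← Real.rpow_neg hb.le, ← Real.rpow_add hb]; ring_nf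
    rw [hs, eg, eb, Real.div_rpow hg.le hb.le, Real.mul_rpow hg.le hb.le]
    have : 0 < g ^ (α/2) := by positivity
    have : 0 < b ^ (α/2) := by positivity
    field_simp
    ring
  rw [e6, Real.mul_rpow hs0.le (by positivity), ← hd, ← Real.rpow_mul (by positivity)]
  have e7 : α / 2 * -(1/α) = -(1/2) := by field_simp
  rw [e7, Real.rpow_neg (by positivity), ← Real.sqrt_eq_rpow, div_eq_mul_inv]

lemma aux_one_add_sum (u : ℕ → ℝ) (hu : ∀ j, 0 ≤ u j) (n : ℕ) :
    1 + ∑ j ∈ Finset.range n, u j ≤ ∏ j ∈ Finset.range n, (1 + u j) := by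
  induction n with
  | zero => simp
  | succ k ih =>
    rw [Finset.sum_range_succ, Finset.prod_range_succ]
    have h1 := hu k
    have h2 : 0 ≤ ∑ j ∈ Finset.range k, u j := Finset.sum_nonneg fun j _ => hu j
    nlinarith [mul_le_mul_of_nonneg_right ih h1, mul_nonneg h2 h1]

lemma aux_tendsto (α : ℝ) (hα : 0 < α) (t : ℕ → ℝ) (ht : ∀ j, 0 < t j)
    (hdiv : ¬ Summable (fun j => (t j - 1) ^ 2)) :
    Filter.Tendsto (fun n => ∏ j ∈ Finset.range n, ((t j + (t j)⁻¹) / 2) ^ (-(1/α)))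
      Filter.atTop (nhds 0) := by
  set u : ℕ → ℝ := fun j => (t j - 1) ^ 2 / (2 * t j) with hu
  have hu0 : ∀ j, 0 ≤ u j := fun j => by have := ht j; positivity
  have hus : ¬ Summable u := by
    intro h
    apply hdiv
    have h1 : ∀ᶠ j in Filter.atTop, u j < 1/2 :=
      h.tendsto_atTop_zero.eventually (gt_mem_nhds (by norm_num))
    refine Summable.of_norm_bounded_eventually_nat (g := fun j => 6 * u j) (h.mul_left 6) ?_
    filter_upwards [h1] with j hj
    have htj := ht j
    rw [Real.norm_of_nonneg (sq_nonneg _)]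
    have e : (t j - 1) ^ 2 = u j * (2 * t j) := by simp only [hu]; field_simp
    have h3 : t j ≤ 3 := by
      by_contra! hc
      nlinarith
    rw [e]
    nlinarith [hu0 j]
  have hsum := (not_summable_iff_tendsto_nat_atTop_of_nonneg hu0).1 hus
  have hprod : Filter.Tendsto (fun n => ∏ j ∈ Finset.range n, (1 + u j))
      Filter.atTop Filter.atTop :=
    Filter.tendsto_atTop_mono (aux_one_add_sum u hu0)
      (Filter.tendsto_atTop_add_const_left _ 1 hsum)
  have h := (tendsto_rpow_neg_atTop (y := 1/α) (by positivity)).comp hprod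
  refine h.congr fun n => ?_
  simp only [Function.comp]
  rw [← Real.finsetProd_rpow _ _ (fun j _ => by have := hu0 j; positivity)]
  refine Finset.prod_congr rfl fun j _ => ?_
  congr 1
  have := ht j
  simp only [hu]
  field_simp
  ring



/-- Kakutani dichotomy for the product measures `μ_γ = ⊗_j f_{γ_j} dx` with densities
`f_g(x) = (c_α/g) exp(-(|x|/g)^α)`, `α ≥ 2`: if `∑_j ((γ_j/β_j)^{α/2} - 1)² = ∞`, then
`μ_γ` and `μ_β` are mutually singular. The infinite product measures are characterized
by their finite-dimensional marginals. -/
theorem stmt12 (α cα : ℝ) (hα : 2 ≤ α) (hcα : 0 < cα)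
    (f : ℝ → ℝ → ℝ) (hf : ∀ g x, f g x = cα / g * Real.exp (-(|x| / g) ^ α))
    (hprob : ∀ g : ℝ, 0 < g → IsProbabilityMeasure
      ((volume : Measure ℝ).withDensity (fun x => ENNReal.ofReal (f g x))))
    (γ β : ℕ → ℝ) (hγ : ∀ j, 0 < γ j) (hβ : ∀ j, 0 < β j)
    (μγ μβ : Measure (ℕ → ℝ)) [IsProbabilityMeasure μγ] [IsProbabilityMeasure μβ]
    (hμγ : ∀ n : ℕ, μγ.map (fun x (i : Fin n) => x i) =
      Measure.pi (fun i : Fin n =>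
        (volume : Measure ℝ).withDensity (fun x => ENNReal.ofReal (f (γ i) x))))
    (hμβ : ∀ n : ℕ, μβ.map (fun x (i : Fin n) => x i) =
      Measure.pi (fun i : Fin n =>
        (volume : Measure ℝ).withDensity (fun x => ENNReal.ofReal (f (β i) x))))
    (hdiv : ¬ Summable (fun j => ((γ j / β j) ^ (α/2) - 1) ^ 2)) :
    μγ ⟂ₘ μβ := by
  have hα0 : 0 < α := by linarith
  have hfm : ∀ g, Measurable (f g) := fun g => by
    have : f g = fun x => cα / g * Real.exp (-(|x| / g) ^ α) := funext (hf g)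
    rw [this]
    fun_prop
  have hfpos : ∀ g, 0 < g → ∀ x, 0 < f g x := fun g hg x => by rw [hf]; positivity
  set t : ℕ → ℝ := fun j => (γ j / β j) ^ (α/2) with ht
  have ht0 : ∀ j, 0 < t j := fun j => by have := hγ j; have := hβ j; positivity
  set p : ℕ → ℝ := fun j => ((t j + (t j)⁻¹) / 2) ^ (-(1/α)) with hp
  have hp0 : ∀ j, 0 ≤ p j := fun j => by have := ht0 j; positivity
  have hlim := aux_tendsto α hα0 t ht0 hdiv
  have hrm : ∀ a b, Measurable (fun x => ENNReal.ofReal (√(f a x / f b x))) := fun a b => by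
    have := hfm a
    have := hfm b
    fun_prop
  have hP : ∀ n, ∏ i : Fin n, ENNReal.ofReal (p i) =
      ENNReal.ofReal (∏ j ∈ Finset.range n, p j) := fun n => by
    rw [ENNReal.ofReal_prod_of_nonneg (fun j _ => hp0 j), Fin.prod_univ_eq_prod_range
      (fun j => ENNReal.ofReal (p j))]
  refine aux_singular μγ μβ
    (fun n => {x | 1 ≤ ∏ i : Fin n, ENNReal.ofReal (√(f (β i) (x i) / f (γ i) (x i)))})
    (fun n => ENNReal.ofReal (∏ j ∈ Finset.range n, p j)) ?_ ?_ ?_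
  · intro n
    have : ∀ i : Fin n, IsProbabilityMeasure
      ((volume : Measure ℝ).withDensity (fun x => ENNReal.ofReal (f (γ i) x))) :=
      fun i => hprob _ (hγ i)
    refine (aux_chernoff μγ n _ (hμγ n)
      (fun i x => ENNReal.ofReal (√(f (β i) x / f (γ i) x))) (fun i => hrm _ _)).trans ?_
    rw [← hP]
    refine le_of_eq (Finset.prod_congr rfl fun i _ => ?_)
    rw [aux_one_dim α cα hα hcα f hf hprob _ _ (hβ i) (hγ i)]
    have : (β i / γ i) ^ (α/2) = (t i)⁻¹ := by
      rw [ht, ← Real.inv_rpow (div_pos (hγ i) (hβ i)).le, inv_div]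
    rw [this, inv_inv, add_comm]
  · intro n
    have : ∀ i : Fin n, IsProbabilityMeasure
      ((volume : Measure ℝ).withDensity (fun x => ENNReal.ofReal (f (β i) x))) :=
      fun i => hprob _ (hβ i)
    refine (measure_mono ?_).trans ((aux_chernoff μβ n _ (hμβ n)
      (fun i x => ENNReal.ofReal (√(f (γ i) x / f (β i) x))) (fun i => hrm _ _)).trans ?_)
    · intro x hx
      simp only [Set.mem_compl_iff, Set.mem_ofPred_eq, not_le] at hx ⊢
      rw [← ENNReal.ofReal_prod_of_nonneg (fun _ _ => Real.sqrt_nonneg _)] at hx ⊢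
      rw [ENNReal.ofReal_lt_one] at hx
      rw [ENNReal.one_le_ofReal]
      have e : ∏ i : Fin n, √(f (γ i) (x i) / f (β i) (x i)) =
          (∏ i : Fin n, √(f (β i) (x i) / f (γ i) (x i)))⁻¹ := by
        rw [← Finset.prod_inv_distrib]
        refine Finset.prod_congr rfl fun i _ => ?_
        rw [← Real.sqrt_inv, inv_div]
      rw [e]
      refine (one_le_inv₀ ?_).2 hx.le
      exact Finset.prod_pos fun i _ => Real.sqrt_pos.2
        (div_pos (hfpos _ (hβ i) _) (hfpos _ (hγ i) _))
    · rw [← hP]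
      refine le_of_eq (Finset.prod_congr rfl fun i _ => ?_)
      rw [aux_one_dim α cα hα hcα f hf hprob _ _ (hγ i) (hβ i)]
  · have := ENNReal.tendsto_ofReal hlim
    rwa [ENNReal.ofReal_zero] at this
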